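/- There does not exist a (4,6)-net in ℂℙ². -/

import Mathlib

/-- An `(n,k)`-net in `ℂℙ²`. Points of `ℂℙ²` are the 1-dimensional `ℂ`-linear
subspaces of `ℂ³` and lines are the 2-dimensional subspaces; a point `p` lies
on a line `ℓ` iff `p ≤ ℓ`. `A` assigns to each `i : Fin n` a finite set of `k`
lines, the classes `A i` are pairwise disjoint, `χ` is a finite set of points,
lines from different classes are distinct and meet in a point of `χ`, and
through every point of `χ` there passes exactly one line of each class. -/
structure IsNet (n k : ℕ) (A : Fin n → Finset (Submodule ℂ (Fin 3 → ℂ)))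
    (χ : Finset (Submodule ℂ (Fin 3 → ℂ))) : Prop where
  three_le : 3 ≤ n
  line_dim : ∀ i, ∀ ℓ ∈ A i, Module.finrank ℂ ℓ = 2
  point_dim : ∀ p ∈ χ, Module.finrank ℂ p = 1
  card_eq : ∀ i, (A i).card = k
  classes_disjoint : ∀ i j, i ≠ j → Disjoint (A i) (A j)
  inter_mem : ∀ i j, i ≠ j → ∀ ℓ₁ ∈ A i, ∀ ℓ₂ ∈ A j, ℓ₁ ≠ ℓ₂ ∧ ℓ₁ ⊓ ℓ₂ ∈ χ
  unique_line : ∀ X ∈ χ, ∀ i, ∃! ℓ, ℓ ∈ A i ∧ X ≤ ℓ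


abbrev Blk4 := ℕ × ℕ × ℕ × ℕ


def good46 (x : Blk4) : Bool :=
  match x with
  | (a, b, c, d) =>
    let A := Nat.blt a 2
    let B := Nat.blt b 2
    let C := Nat.blt c 2
    let D := Nat.blt d 2
    ((!A && !B && !C && !D) || (A && B && !C && !D && Nat.beq c (2 + 2 * a + b) && Nat.beq d (2 + 2 * a + b))
      || (A && !B && C && !D && Nat.beq b (2 + 2 * a + c)) || (A && !B && !C && D)
      || (!A && B && C && !D && Nat.beq a (2 + 2 * b + c)) || (!A && B && !C && D)
      || (!A && !B && C && D))

def opts46 (r c : ℕ) : List Blk4 :=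
  (([0, 1, 2, 3, 4, 5] : List ℕ).flatMap fun l => ([0, 1, 2, 3, 4, 5] : List ℕ).map fun m => (r, c, l, m)).filter good46

def mask46 (x : Blk4) : ℕ :=
  match x with
  | (a, b, c, d) => 2 ^ (6 * a + c) ||| 2 ^ (36 + 6 * a + d) ||| 2 ^ (72 + 6 * b + c) |||
      2 ^ (108 + 6 * b + d) ||| 2 ^ (144 + 6 * c + d)

def search46 : List (ℕ × ℕ) → ℕ → Bool
  | [], _ => true
  | p :: rest, u => (opts46 p.1 p.2).any fun o =>
      match Nat.beq (Nat.land (mask46 o) u) 0 with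
      | false => false
      | true => match Nat.lor (mask46 o) u with
        | 0 => true
        | n + 1 => search46 rest (n + 1)
def order46 : List (ℕ × ℕ) := [(1, 1), (0, 1), (0, 0), (1, 0), (0, 5), (0, 4), (5, 0), (4, 0), (0, 3), (0, 2), (2, 0), (3, 0), (1, 3), (1, 2), (1, 5), (1, 4), (3, 1), (2, 1), (4, 1), (2, 3), (2, 5), (2, 2), (2, 4), (3, 2), (3, 4), (3, 5), (3, 3), (4, 3), (4, 5), (5, 3), (4, 4), (4, 2), (5, 5), (5, 4), (5, 1), (5, 2)]
theorem search46_false : search46 order46 0 = false := by decide +kernel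

theorem search46_sound (f : ℕ × ℕ → Blk4) : ∀ (l : List (ℕ × ℕ)) (u : ℕ),
    (∀ p ∈ l, f p ∈ opts46 p.1 p.2) → (∀ p ∈ l, mask46 (f p) &&& u = 0) →
    l.Pairwise (fun p q => mask46 (f q) &&& mask46 (f p) = 0) → search46 l u = true := by
  intro l
  induction l with
  | nil => intro u _ _ _; rfl
  | cons p rest ih =>
    intro u h1 h2 h3
    rw [List.pairwise_cons] at h3
    unfold search46
    rw [List.any_eq_true]
    refine ⟨f p, h1 p (by simp), ?_⟩
    have e : Nat.land (mask46 (f p)) u = 0 := h2 p (by simp)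
    rw [e]
    have key : search46 rest (mask46 (f p) ||| u) = true := by
      apply ih
      · intro q hq; exact h1 q (by simp [hq])
      · intro q hq
        rw [Nat.and_or_distrib_left, h3.1 q hq, h2 q (by simp [hq])]; rfl
      · exact h3.2
    have key' : search46 rest (Nat.lor (mask46 (f p)) u) = true := key
    simp only
    generalize Nat.lor (mask46 (f p)) u = w at key'
    cases w with
    | zero => rfl
    | succ n => exact key'

theorem two_pow_and46 {m n : ℕ} (h : m ≠ n) : 2 ^ m &&& 2 ^ n = 0 := by
  apply Nat.eq_of_testBit_eq
  intro i
  simp only [Nat.testBit_and, Nat.testBit_two_pow, Nat.zero_testBit]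
  by_cases h1 : m = i
  · have : n ≠ i := fun h2 => h (h1.trans h2.symm)
    simp [this]
  · simp [h1]

theorem mask46_disj {a b c d a' b' c' d' : ℕ} (hc : c < 6) (hd : d < 6)
    (hc' : c' < 6) (hd' : d' < 6) (ha : a < 6) (ha' : a' < 6) (hb : b < 6) (hb' : b' < 6)
    (h1 : a = a' → c ≠ c') (h2 : a = a' → d ≠ d')
    (h3 : b = b' → c ≠ c') (h4 : b = b' → d ≠ d') (h5 : c = c' → d ≠ d') :
    mask46 (a, b, c, d) &&& mask46 (a', b', c', d') = 0 := by
  unfold mask46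
  simp only [Nat.and_or_distrib_left, Nat.and_or_distrib_right]
  repeat rw [two_pow_and46 (by omega)]
  rfl

structure TD46 (B : (Fin 4 → Fin 6) → Prop) : Prop where
  ex : ∀ i j, i ≠ j → ∀ a b, ∃ x, B x ∧ x i = a ∧ x j = b
  uniq : ∀ i j, i ≠ j → ∀ x y, B x → B y → x i = y i → x j = y j → x = y

/-- number of coordinates below 2 is 0 or 2 -/
def Pat46 (B : (Fin 4 → Fin 6) → Prop) : Prop :=
  ∀ x, B x → (∑ i, (if (x i).val < 2 then 1 else 0) = 0 ∨ ∑ i, (if (x i).val < 2 then 1 else 0) = 2)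

theorem final46 {B : (Fin 4 → Fin 6) → Prop} (hB : TD46 B) (hP : Pat46 B)
    (n0 : ∀ x, B x → (x 1).val < 2 → (x 2).val < 2 → (x 0).val = 2 + 2 * (x 1).val + (x 2).val)
    (n1 : ∀ x, B x → (x 0).val < 2 → (x 2).val < 2 → (x 1).val = 2 + 2 * (x 0).val + (x 2).val)
    (n2 : ∀ x, B x → (x 0).val < 2 → (x 1).val < 2 → (x 2).val = 2 + 2 * (x 0).val + (x 1).val)
    (n3 : ∀ x, B x → (x 0).val < 2 → (x 1).val < 2 → (x 3).val = 2 + 2 * (x 0).val + (x 1).val) :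
    False := by
  choose g hg1 hg2 hg3 using hB.ex 0 1 (by decide)
  let F : ℕ × ℕ → (Fin 4 → Fin 6) := fun p => g (Fin.ofNat 6 p.1) (Fin.ofNat 6 p.2)
  have F0 : ∀ p, p.1 < 6 → (F p 0).val = p.1 := by
    intro p hp; simp [F, hg2, Nat.mod_eq_of_lt hp]
  have F1 : ∀ p, p.2 < 6 → (F p 1).val = p.2 := by
    intro p hp; simp [F, hg3, Nat.mod_eq_of_lt hp]
  have FB : ∀ p, B (F p) := fun p => hg1 _ _
  let f : ℕ × ℕ → Blk4 := fun p => ((F p 0).val, (F p 1).val, (F p 2).val, (F p 3).val)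
  have hord : ∀ p ∈ order46, p.1 < 6 ∧ p.2 < 6 := by decide
  have hnd : order46.Nodup := by decide
  have : search46 order46 0 = true := by
    apply search46_sound f
    · intro p hp
      unfold opts46
      rw [List.mem_filter]
      have mem6 : ∀ n : ℕ, n < 6 → n ∈ ([0, 1, 2, 3, 4, 5] : List ℕ) := by decide
      constructor
      · rw [List.mem_flatMap]
        refine ⟨(F p 2).val, mem6 _ (F p 2).isLt, ?_⟩
        rw [List.mem_map]
        refine ⟨(F p 3).val, mem6 _ (F p 3).isLt, ?_⟩
        simp only [f, F0 p (hord p hp).1, F1 p (hord p hp).2]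
      · have q := hP _ (FB p)
        have q0 := n0 _ (FB p)
        have q1 := n1 _ (FB p)
        have q2 := n2 _ (FB p)
        have q3 := n3 _ (FB p)
        simp only [f]
        rw [Fin.sum_univ_four] at q
        generalize (F p 0).val = a at *
        generalize (F p 1).val = b at *
        generalize (F p 2).val = c at *
        generalize (F p 3).val = d at *
        simp only [good46, Bool.or_eq_true, Bool.and_eq_true, Bool.not_eq_true', Nat.beq_eq,
          Nat.blt_eq, Bool.eq_false_iff, ne_eq]
        by_cases ha : a < 2 <;> by_cases hb : b < 2 <;> by_cases hc : c < 2 <;>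
          by_cases hd : d < 2 <;> simp [ha, hb, hc, hd] at q q0 q1 q2 q3 ⊢ <;> omega
    · intro p _; exact Nat.and_zero _
    · have : order46.Pairwise (fun p q => p ≠ q) := hnd
      refine List.Pairwise.imp_of_mem ?_ this
      intro p q hp hq hpq
      obtain ⟨hp1, hp2⟩ := hord p hp
      obtain ⟨hq1, hq2⟩ := hord q hq
      have hne : ∀ i j, i ≠ j → F q i = F p i → F q j ≠ F p j := by
        intro i j hij h1 h2
        have := hB.uniq i j hij _ _ (FB q) (FB p) h1 h2
        apply hpq
        ext
        · rw [← F0 p hp1, ← F0 q hq1, this]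
        · rw [← F1 p hp2, ← F1 q hq2, this]
      have hne' : ∀ i j, i ≠ j → (F q i).val = (F p i).val → (F q j).val ≠ (F p j).val := by
        intro i j hij h1 h2
        exact hne i j hij (Fin.ext h1) (Fin.ext h2)
      apply mask46_disj
      any_goals exact Fin.isLt _
      all_goals apply hne' _ _ (by decide)
  rw [search46_false] at this
  cases this

theorem univ46 : ∀ i j k l : Fin 4, i ≠ j → i ≠ k → i ≠ l → j ≠ k → j ≠ l → k ≠ l →
    (Finset.univ : Finset (Fin 4)) = {i, j, k, l} := by decide

theorem sum46 {i j k l : Fin 4} (h1 : i ≠ j) (h2 : i ≠ k) (h3 : i ≠ l) (h4 : j ≠ k) (h5 : j ≠ l)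
    (h6 : k ≠ l) (f : Fin 4 → ℕ) : ∑ t, f t = f i + f j + f k + f l := by
  rw [univ46 i j k l h1 h2 h3 h4 h5 h6]
  rw [Finset.sum_insert, Finset.sum_insert, Finset.sum_insert, Finset.sum_singleton]
  · ring
  all_goals simp [*]

theorem fourth46 : ∀ i j k : Fin 4, ∃ l : Fin 4, i ≠ l ∧ j ≠ l ∧ k ≠ l := by decide

theorem two46 {a b c : ℕ} (ha : a < 2) (hb : b < 2) (hc : c < 2) (h : a ≠ b) :
    c = a ∨ c = b := by omega

theorem inj46 {B : (Fin 4 → Fin 6) → Prop} (hB : TD46 B) (hP : Pat46 B) {i j k : Fin 4}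
    (hij : i ≠ j) (hik : i ≠ k) (hjk : j ≠ k) {x y : Fin 4 → Fin 6} (hx : B x) (hy : B y)
    (xj : (x j).val < 2) (xk : (x k).val < 2) (yj : (y j).val < 2) (yk : (y k).val < 2)
    (hi : x i = y i) : x = y := by
  by_contra hne
  have hj : (x j).val ≠ (y j).val := fun h => hne (hB.uniq i j hij x y hx hy hi (Fin.ext h))
  have hk : (x k).val ≠ (y k).val := fun h => hne (hB.uniq i k hik x y hx hy hi (Fin.ext h))
  obtain ⟨l, hil, hjl, hkl⟩ : ∃ l : Fin 4, i ≠ l ∧ j ≠ l ∧ k ≠ l :=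
    fourth46 i j k
  obtain ⟨z, hz, zi, zl⟩ := hB.ex i l hil (x i) 0
  have px := hP x hx
  have py := hP y hy
  have pz := hP z hz
  rw [sum46 hij hik hil hjk hjl hkl] at px py pz
  rw [← hi] at py
  rw [zi, zl] at pz
  have zxj : z j = x j → False := fun h => by
    have := hB.uniq i j hij z x hz hx zi h
    rw [← this, zl] at px
    rw [← this] at xj xk
    simp [xj, xk] at px
  have zyj : z j = y j → False := fun h => by
    have := hB.uniq i j hij z y hz hy (zi.trans hi) h
    rw [← this, zl] at py
    rw [← this] at yj yk
    simp [yj, yk] at py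
  have zxk : z k = x k → False := fun h => by
    have := hB.uniq i k hik z x hz hx zi h
    rw [← this, zl] at px
    rw [← this] at xj xk
    simp [xj, xk] at px
  have zyk : z k = y k → False := fun h => by
    have := hB.uniq i k hik z y hz hy (zi.trans hi) h
    rw [← this, zl] at py
    rw [← this] at yj yk
    simp [yj, yk] at py
  have a1 : ¬ (z j).val < 2 := fun h => by
    rcases two46 xj yj h hj with h | h
    · exact zxj (Fin.ext h)
    · exact zyj (Fin.ext h)
  have a2 : ¬ (z k).val < 2 := fun h => by
    rcases two46 xk yk h hk with h | h
    · exact zxk (Fin.ext h)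
    · exact zyk (Fin.ext h)
  simp [a1, a2] at pz
  simp [xj, xk] at px
  clear py
  split_ifs at px pz <;> omega

theorem permTD46 {B : (Fin 4 → Fin 6) → Prop} (hB : TD46 B) (σ : Fin 4 → Equiv.Perm (Fin 6)) :
    TD46 (fun x => B (fun i => σ i (x i))) := by
  constructor
  · intro i j hij a b
    obtain ⟨x, hx, h1, h2⟩ := hB.ex i j hij (σ i a) (σ j b)
    refine ⟨fun i => (σ i).symm (x i), by simpa using hx, by simp [h1], by simp [h2]⟩
  · intro i j hij x y hx hy h1 h2
    have := hB.uniq i j hij _ _ hx hy (by simp [h1]) (by simp [h2])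
    funext t
    exact (σ t).injective (congrFun this t)

theorem tau46 {B : (Fin 4 → Fin 6) → Prop} (hB : TD46 B) (hP : Pat46 B) {i j k : Fin 4}
    (hij : i ≠ j) (hik : i ≠ k) (hjk : j ≠ k) : ∃ τ : Equiv.Perm (Fin 6),
    (∀ c : Fin 6, c.val < 2 → τ c = c) ∧ (∀ c : Fin 6, 2 ≤ c.val → 2 ≤ (τ c).val) ∧
    (∀ x, B x → (x j).val < 2 → (x k).val < 2 →
      ∀ c : Fin 6, c.val = 2 + 2 * (x j).val + (x k).val → x i = τ c) := by
  choose g hg1 hg2 hg3 using hB.ex j k hjk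
  obtain ⟨l, hil, hjl, hkl⟩ : ∃ l : Fin 4, i ≠ l ∧ j ≠ l ∧ k ≠ l :=
    fourth46 i j k
  let p : Fin 6 → Fin 6 := fun c => Fin.ofNat 6 ((c.val - 2) / 2)
  let q : Fin 6 → Fin 6 := fun c => Fin.ofNat 6 ((c.val - 2) % 2)
  have hp : ∀ c, (p c).val = (c.val - 2) / 2 := by decide
  have hq : ∀ c, (q c).val = (c.val - 2) % 2 := by decide
  have big : ∀ x, B x → (x j).val < 2 → (x k).val < 2 → 2 ≤ (x i).val := by
    intro x hx h1 h2
    have := hP x hx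
    rw [sum46 hij hik hil hjk hjl hkl] at this
    by_contra h3
    simp [h1, h2, show (x i).val < 2 by omega] at this
    split_ifs at this <;> omega
  let t : Fin 6 → Fin 6 := fun c => if c.val < 2 then c else g (p c) (q c) i
  have t1 : ∀ c : Fin 6, c.val < 2 → t c = c := by intro c h; exact if_pos h
  have t2' : ∀ c : Fin 6, 2 ≤ c.val → t c = g (p c) (q c) i := by
    intro c h; exact if_neg (by omega)
  have pj : ∀ c, (g (p c) (q c) j).val < 2 := by
    intro c; rw [hg2, hp]; omega
  have pk : ∀ c, (g (p c) (q c) k).val < 2 := by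
    intro c; rw [hg3, hq]; omega
  have t2 : ∀ c : Fin 6, 2 ≤ c.val → 2 ≤ (t c).val := by
    intro c h
    rw [t2' c h]
    exact big _ (hg1 _ _) (pj c) (pk c)
  have tinj : Function.Injective t := by
    intro c d h
    by_cases hc : c.val < 2 <;> by_cases hd : d.val < 2
    · rwa [t1 c hc, t1 d hd] at h
    · have := t2 d (by omega)
      rw [← h, t1 c hc] at this; omega
    · have := t2 c (by omega)
      rw [h, t1 d hd] at this; omega
    · rw [t2' c (by omega), t2' d (by omega)] at h
      have := inj46 hB hP hij hik hjk (hg1 _ _) (hg1 _ _) (pj c) (pk c) (pj d) (pk d) h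
      have e1 := congrArg Fin.val (congrFun this j)
      have e2 := congrArg Fin.val (congrFun this k)
      rw [hg2, hg2, hp, hp] at e1
      rw [hg3, hg3, hq, hq] at e2
      ext; omega
  refine ⟨Equiv.ofBijective t (Finite.injective_iff_bijective.mp tinj), t1, t2, ?_⟩
  intro x hx h1 h2 c hc
  change x i = t c
  rw [t2' c (by omega)]
  have : x = g (p c) (q c) := by
    apply hB.uniq j k hjk _ _ hx (hg1 _ _)
    · rw [hg2]; ext; rw [hp]; omega
    · rw [hg3]; ext; rw [hq]; omega
  rw [← this]

theorem noPat46 {B : (Fin 4 → Fin 6) → Prop} (hB : TD46 B) (hP : Pat46 B) : False := by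
  have key : ∀ i : Fin 4, ∀ j k : Fin 4, i ≠ j → i ≠ k → j ≠ k → ∃ τ : Equiv.Perm (Fin 6),
    (∀ c : Fin 6, c.val < 2 → τ c = c) ∧ (∀ c : Fin 6, 2 ≤ c.val → 2 ≤ (τ c).val) ∧
    (∀ x, B x → (x j).val < 2 → (x k).val < 2 →
      ∀ c : Fin 6, c.val = 2 + 2 * (x j).val + (x k).val → x i = τ c) :=
    fun i j k h1 h2 h3 => tau46 hB hP h1 h2 h3
  let J : Fin 4 → Fin 4 := ![1, 0, 0, 0]
  let K : Fin 4 → Fin 4 := ![2, 2, 1, 1]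
  choose τ T1 T2 T3 using fun i : Fin 4 => key i (J i) (K i) (by revert i; decide)
    (by revert i; decide) (by revert i; decide)
  have small : ∀ i c, (τ i c).val < 2 ↔ c.val < 2 := by
    intro i c
    constructor
    · intro h
      by_contra h2
      have := T2 i c (by omega)
      omega
    · intro h; rw [T1 i c h]; exact h
  have hB' := permTD46 hB τ
  have hP' : Pat46 (fun x => B (fun i => τ i (x i))) := by
    intro x hx
    have := hP _ hx
    simpa only [small] using this
  have nn : ∀ (i : Fin 4) (x : Fin 4 → Fin 6), B (fun i => τ i (x i)) → (x (J i)).val < 2 → (x (K i)).val < 2 →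
      (x i).val = 2 + 2 * (x (J i)).val + (x (K i)).val := by
    intro i x hx h1 h2
    have h := T3 i _ hx ((small _ _).2 h1) ((small _ _).2 h2)
      ⟨2 + 2 * (x (J i)).val + (x (K i)).val, by omega⟩
      (by simp only; rw [T1 _ _ h1, T1 _ _ h2])
    have := (τ i).injective h
    rw [this]
  exact final46 hB' hP' (nn 0) (nn 1) (nn 2) (nn 3)

/-- weight of a class -/
def wt46 (v : Fin 4 → Fin 6 → ZMod 2) (i : Fin 4) : ℕ := ∑ a, (v i a).val

/-- `v` sums to zero on each block -/
def Ev46 (B : (Fin 4 → Fin 6) → Prop) (v : Fin 4 → Fin 6 → ZMod 2) : Prop :=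
  ∀ x, B x → ∑ i, v i (x i) = 0

theorem star46 {B : (Fin 4 → Fin 6) → Prop} (hB : TD46 B) {i j k l : Fin 4} (h1 : i ≠ j)
    (h2 : i ≠ k) (h3 : i ≠ l) (a : Fin 6)
    (v : Fin 4 → Fin 6 → ZMod 2) :
    ∃ g : Fin 6 → (Fin 4 → Fin 6), (∀ b, B (g b)) ∧ (∀ b, g b i = a) ∧
      (∀ x, B x → x i = a → ∃ b, x = g b) ∧
      ∑ b, ((v j (g b j)).val + (v k (g b k)).val + (v l (g b l)).val) =
        wt46 v j + wt46 v k + wt46 v l := by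
  choose g hg1 hg2 hg3 using hB.ex i j h1 a
  have bij : ∀ t, i ≠ t → Function.Bijective (fun b => g b t) := by
    intro t ht
    rw [← Finite.injective_iff_bijective]
    intro b c hbc
    have := hB.uniq i t ht _ _ (hg1 b) (hg1 c) (by rw [hg2, hg2]) hbc
    rw [← hg3 b, ← hg3 c, this]
  refine ⟨g, hg1, hg2, ?_, ?_⟩
  · intro x hx hxi
    exact ⟨x j, hB.uniq i j h1 _ _ hx (hg1 _) (by rw [hg2, hxi]) (by rw [hg3])⟩
  · rw [Finset.sum_add_distrib, Finset.sum_add_distrib]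
    unfold wt46
    rw [(bij j h1).sum_comp (fun c => (v j c).val), (bij k h2).sum_comp (fun c => (v k c).val),
      (bij l h3).sum_comp (fun c => (v l c).val)]

theorem par46 : ∀ p q r s : ZMod 2, p + q + r + s = 0 →
    (q.val + r.val + s.val) % 2 = p.val ∧ q.val + r.val + s.val ≤ 3 := by decide

theorem sumz46 {i j k l : Fin 4} (h1 : i ≠ j) (h2 : i ≠ k) (h3 : i ≠ l) (h4 : j ≠ k) (h5 : j ≠ l)
    (h6 : k ≠ l) (f : Fin 4 → ZMod 2) : ∑ t, f t = f i + f j + f k + f l := by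
  rw [univ46 i j k l h1 h2 h3 h4 h5 h6]
  rw [Finset.sum_insert, Finset.sum_insert, Finset.sum_insert, Finset.sum_singleton]
  · ring
  all_goals simp [*]

theorem local46 {B : (Fin 4 → Fin 6) → Prop} (hB : TD46 B) {v : Fin 4 → Fin 6 → ZMod 2}
    (hv : Ev46 B v) {i j k l : Fin 4} (h1 : i ≠ j)
    (h2 : i ≠ k) (h3 : i ≠ l) (h4 : j ≠ k) (h5 : j ≠ l) (h6 : k ≠ l) (a : Fin 6) :
    (wt46 v j + wt46 v k + wt46 v l) % 2 = 0 ∧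
    (v i a = 1 → 6 ≤ wt46 v j + wt46 v k + wt46 v l) ∧
    (v i a = 1 → wt46 v j + wt46 v k + wt46 v l = 6 → ∀ x, B x → x i = a →
      (v j (x j)).val + (v k (x k)).val + (v l (x l)).val = 1) ∧
    (v i a = 1 → 6 < wt46 v j + wt46 v k + wt46 v l → ∃ x, B x ∧ x i = a ∧
      (v j (x j)).val + (v k (x k)).val + (v l (x l)).val = 3) := by
  obtain ⟨g, g1, g2, g3, g4⟩ := star46 hB h1 h2 h3 a v
  have hp : ∀ b, ((v j (g b j)).val + (v k (g b k)).val + (v l (g b l)).val) % 2 = (v i a).val ∧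
      (v j (g b j)).val + (v k (g b k)).val + (v l (g b l)).val ≤ 3 := by
    intro b
    have := hv _ (g1 b)
    rw [sumz46 h1 h2 h3 h4 h5 h6 (fun t => v t (g b t)), g2] at this
    exact par46 _ _ _ _ this
  generalize wt46 v j + wt46 v k + wt46 v l = W at *
  obtain ⟨T, hT⟩ : ∃ T : Fin 6 → ℕ, ∀ b,
    T b = (v j (g b j)).val + (v k (g b k)).val + (v l (g b l)).val := ⟨_, fun _ => rfl⟩
  simp only [← hT] at hp g4
  rw [Fin.sum_univ_six] at g4
  have hv1 : (1 : ZMod 2).val = 1 := rfl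
  have hu : ∀ b, ∃ u, T b = 2 * u + (v i a).val := fun b => ⟨T b / 2, by
    have := (hp b).1
    omega⟩
  choose u hu using hu
  have g5 : W = 2 * (u 0 + u 1 + u 2 + u 3 + u 4 + u 5) + 6 * (v i a).val := by
    rw [← g4, hu 0, hu 1, hu 2, hu 3, hu 4, hu 5]; ring
  clear g4
  refine ⟨?_, ?_, ?_, ?_⟩
  · rw [g5]; omega
  · intro h; rw [h, hv1] at g5; omega
  · intro h hW x hx hxa
    rw [h, hv1] at g5
    obtain ⟨b, rfl⟩ := g3 x hx hxa
    rw [← hT, hu, h, hv1]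
    clear hp hu hT
    fin_cases b <;> simp only [Fin.zero_eta, Fin.mk_one, Fin.reduceFinMk] <;> omega
  · intro h hW
    by_contra hcon
    push Not at hcon
    have hc : ∀ b, u b = 0 := fun b => by
      have h3 : T b ≠ 3 := by rw [hT]; exact hcon _ (g1 b) (g2 b)
      have h4 := (hp b).2
      have h5 := hu b
      rw [h, hv1] at h5
      clear hp hu hT g5
      omega
    rw [h, hv1, hc, hc, hc, hc, hc, hc] at g5
    omega

theorem wt_pos46 {v : Fin 4 → Fin 6 → ZMod 2} {i : Fin 4} (h : 0 < wt46 v i) :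
    ∃ a, v i a = 1 := by
  by_contra hcon
  push Not at hcon
  have : ∀ p : ZMod 2, p ≠ 1 → p.val = 0 := by decide
  unfold wt46 at h
  rw [Finset.sum_eq_zero (fun a _ => this _ (hcon a))] at h
  omega

theorem wt_le46 (v : Fin 4 → Fin 6 → ZMod 2) (i : Fin 4) : wt46 v i ≤ 6 := by
  unfold wt46
  calc ∑ a, (v i a).val ≤ ∑ a : Fin 6, 1 := Finset.sum_le_sum (fun a _ => by
        have := ZMod.val_lt (v i a); omega)
    _ = 6 := by simp

theorem wt_zero46 {v : Fin 4 → Fin 6 → ZMod 2} {i : Fin 4} (h : wt46 v i = 0) (a : Fin 6) :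
    v i a = 0 := by
  unfold wt46 at h
  have := (Finset.sum_eq_zero_iff.mp h) a (Finset.mem_univ _)
  exact (ZMod.val_eq_zero _).mp this

theorem wt_flip46 (v : Fin 4 → Fin 6 → ZMod 2) (c : Fin 4 → ZMod 2) (i : Fin 4) :
    (c i = 0 → wt46 (fun i a => v i a + c i) i = wt46 v i) ∧
    (c i = 1 → wt46 (fun i a => v i a + c i) i = 6 - wt46 v i) := by
  constructor
  · intro h; simp [wt46, h]
  · intro h
    have e : wt46 (fun i a => v i a + c i) i + wt46 v i = 6 := by
      unfold wt46
      rw [← Finset.sum_add_distrib]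
      have : ∀ p : ZMod 2, (p + 1).val + p.val = 1 := by decide
      simp [h, this]
    omega

theorem even46 {B : (Fin 4 → Fin 6) → Prop} (hB : TD46 B) {v : Fin 4 → Fin 6 → ZMod 2}
    (hv : Ev46 B v) (i : Fin 4) : wt46 v i % 2 = 0 := by
  have a := (local46 hB hv (i := 0) (j := 1) (k := 2) (l := 3) (by decide) (by decide) (by decide)
    (by decide) (by decide) (by decide) 0).1
  have b := (local46 hB hv (i := 1) (j := 0) (k := 2) (l := 3) (by decide) (by decide) (by decide)
    (by decide) (by decide) (by decide) 0).1
  have c := (local46 hB hv (i := 2) (j := 0) (k := 1) (l := 3) (by decide) (by decide) (by decide)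
    (by decide) (by decide) (by decide) 0).1
  have d := (local46 hB hv (i := 3) (j := 0) (k := 1) (l := 2) (by decide) (by decide) (by decide)
    (by decide) (by decide) (by decide) 0).1
  fin_cases i <;> simp only [Fin.zero_eta, Fin.mk_one, Fin.reduceFinMk] <;> omega

theorem two_all46 {B : (Fin 4 → Fin 6) → Prop} (hB : TD46 B) {v : Fin 4 → Fin 6 → ZMod 2}
    (hv : Ev46 B v) (hne : ∃ i a, v i a ≠ v i 0) :
    ∃ w, Ev46 B w ∧ ∀ i, wt46 w i = 2 := by
  -- flip classes so that the first three weights are at most two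
  let e : Fin 4 → ZMod 2 := fun i => if wt46 v i ≤ 2 then 0 else 1
  let c : Fin 4 → ZMod 2 := ![e 0, e 1, e 2, e 0 + e 1 + e 2]
  have hc : c 0 + c 1 + c 2 + c 3 = 0 := by
    change e 0 + e 1 + e 2 + (e 0 + e 1 + e 2) = 0
    exact CharTwo.add_self_eq_zero _
  obtain ⟨w, hw⟩ : ∃ w : Fin 4 → Fin 6 → ZMod 2, w = fun i a => v i a + c i := ⟨_, rfl⟩
  have hwE : Ev46 B w := by
    intro x hx
    have := hv x hx
    rw [Fin.sum_univ_four] at this ⊢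
    rw [hw]
    calc v 0 (x 0) + c 0 + (v 1 (x 1) + c 1) + (v 2 (x 2) + c 2) + (v 3 (x 3) + c 3)
        = (v 0 (x 0) + v 1 (x 1) + v 2 (x 2) + v 3 (x 3)) + (c 0 + c 1 + c 2 + c 3) := by ring
      _ = 0 := by rw [this, hc, add_zero]
  have hwne : ∃ i a, w i a ≠ w i 0 := by
    obtain ⟨i, a, h⟩ := hne
    refine ⟨i, a, ?_⟩
    rw [hw]
    simpa using h
  have le2 : ∀ i, c i = e i → wt46 w i ≤ 2 := by
    intro i hi
    have h1 := wt_flip46 v c i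
    rw [← hw] at h1
    have h2 := even46 hB hv i
    by_cases h : wt46 v i ≤ 2
    · have : c i = 0 := by rw [hi]; exact if_pos h
      rw [h1.1 this]; exact h
    · have : c i = 1 := by rw [hi]; exact if_neg h
      rw [h1.2 this]; omega
  have l0 := le2 0 rfl
  have l1 := le2 1 rfl
  have l2 := le2 2 rfl
  have l3 := wt_le46 w 3
  have e0 := even46 hB hwE 0
  have e1 := even46 hB hwE 1
  have e2 := even46 hB hwE 2
  have e3 := even46 hB hwE 3
  have L0 := local46 hB hwE (i := 0) (j := 1) (k := 2) (l := 3) (by decide) (by decide) (by decide)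
    (by decide) (by decide) (by decide)
  have L1 := local46 hB hwE (i := 1) (j := 0) (k := 2) (l := 3) (by decide) (by decide) (by decide)
    (by decide) (by decide) (by decide)
  have L2 := local46 hB hwE (i := 2) (j := 0) (k := 1) (l := 3) (by decide) (by decide) (by decide)
    (by decide) (by decide) (by decide)
  have L3 := local46 hB hwE (i := 3) (j := 0) (k := 1) (l := 2) (by decide) (by decide) (by decide)
    (by decide) (by decide) (by decide)
  have P0 : 0 < wt46 w 0 → 6 ≤ wt46 w 1 + wt46 w 2 + wt46 w 3 := fun h => by
    obtain ⟨a, ha⟩ := wt_pos46 h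
    exact (L0 a).2.1 ha
  have P1 : 0 < wt46 w 1 → 6 ≤ wt46 w 0 + wt46 w 2 + wt46 w 3 := fun h => by
    obtain ⟨a, ha⟩ := wt_pos46 h
    exact (L1 a).2.1 ha
  have P2 : 0 < wt46 w 2 → 6 ≤ wt46 w 0 + wt46 w 1 + wt46 w 3 := fun h => by
    obtain ⟨a, ha⟩ := wt_pos46 h
    exact (L2 a).2.1 ha
  have P3 : 0 < wt46 w 3 → 6 ≤ wt46 w 0 + wt46 w 1 + wt46 w 2 := fun h => by
    obtain ⟨a, ha⟩ := wt_pos46 h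
    exact (L3 a).2.1 ha
  have nz : ¬ (wt46 w 0 = 0 ∧ wt46 w 1 = 0 ∧ wt46 w 2 = 0 ∧ wt46 w 3 = 0) := by
    rintro ⟨z0, z1, z2, z3⟩
    obtain ⟨i, a, h⟩ := hwne
    apply h
    have : wt46 w i = 0 := by
      fin_cases i
      · exact z0
      · exact z1
      · exact z2
      · exact z3
    rw [wt_zero46 this, wt_zero46 this]
  have A0 : wt46 w 0 = 2 := by omega
  have A1 : wt46 w 1 = 2 := by omega
  have A2 : wt46 w 2 = 2 := by omega
  have A3 : wt46 w 3 = 2 := by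
    by_contra hA3
    obtain ⟨a, ha⟩ := wt_pos46 (show 0 < wt46 w 0 by omega)
    obtain ⟨x, hx, hxa, hs⟩ := (L0 a).2.2.2 ha (by omega)
    have b1 := ZMod.val_lt (w 1 (x 1))
    have b2 := ZMod.val_lt (w 2 (x 2))
    have b3 := ZMod.val_lt (w 3 (x 3))
    have v3 : (w 3 (x 3)).val = 1 := by omega
    have z3 : w 3 (x 3) = 1 := by
      revert v3; generalize w 3 (x 3) = q; revert q; decide
    have := (L3 (x 3)).2.2.1 z3 (by omega) x hx rfl
    rw [hxa, ha] at this
    have hv1 : (1 : ZMod 2).val = 1 := rfl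
    omega
  refine ⟨w, hwE, ?_⟩
  intro i
  fin_cases i
  · exact A0
  · exact A1
  · exact A2
  · exact A3

theorem noEv46 {B : (Fin 4 → Fin 6) → Prop} (hB : TD46 B) {v : Fin 4 → Fin 6 → ZMod 2}
    (hv : Ev46 B v) (hne : ∃ i a, v i a ≠ v i 0) : False := by
  obtain ⟨w, hw, h2⟩ := two_all46 hB hv hne
  have hv1 : (1 : ZMod 2).val = 1 := rfl
  have val01 : ∀ p : ZMod 2, p.val = if p = 1 then 1 else 0 := by decide
  have hcard : ∀ i, Fintype.card {a : Fin 6 // a.val < 2} = Fintype.card {a // w i a = 1} := by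
    intro i
    have h := h2 i
    unfold wt46 at h
    simp only [val01] at h
    rw [Finset.sum_boole] at h
    rw [Fintype.card_subtype, Fintype.card_subtype]
    have : (Finset.univ.filter (fun a : Fin 6 => a.val < 2)).card = 2 := by decide
    rw [this]
    exact_mod_cast h.symm
  let σ : Fin 4 → Equiv.Perm (Fin 6) := fun i =>
    (Fintype.equivOfCardEq (hcard i)).extendSubtype
  have hσ : ∀ (i : Fin 4) (c : Fin 6), c.val < 2 ↔ w i (σ i c) = 1 := by
    intro i c
    constructor
    · intro h; exact Equiv.extendSubtype_mem (Fintype.equivOfCardEq (hcard i)) c h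
    · intro h
      by_contra h'
      exact Equiv.extendSubtype_not_mem (Fintype.equivOfCardEq (hcard i)) _ h' h
  apply noPat46 (permTD46 hB σ)
  intro x hx
  have hx : B (fun i => σ i (x i)) := hx
  have hval : ∀ i, (if (x i).val < 2 then 1 else 0) = (w i (σ i (x i))).val := by
    intro i
    rw [val01]
    exact if_congr (hσ i (x i)) rfl rfl
  simp only [hval]
  have e := hw _ hx
  generalize hy : (fun i => σ i (x i)) = y at hx e
  have hy' : ∀ i, σ i (x i) = y i := fun i => congrFun hy i
  simp only [hy'] at e ⊢
  have L0 := (local46 hB hw (i := 0) (j := 1) (k := 2) (l := 3) (by decide) (by decide) (by decide)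
    (by decide) (by decide) (by decide) (y 0)).2.2.1
  have L1 := par46 (w 0 (y 0)) (w 1 (y 1)) (w 2 (y 2)) (w 3 (y 3))
  rw [Fin.sum_univ_four] at e ⊢
  have L1 := L1 e
  by_cases h : w 0 (y 0) = 1
  · have := L0 h (by simp [h2]) y hx rfl
    rw [h, hv1]; omega
  · have h0 : (w 0 (y 0)).val = 0 := by rw [val01, if_neg h]
    omega

/-- Dimension count: if `N` maps a space of codimension at most four into the kernel of its transpose,
then `N` has a kernel of dimension at least four. -/
theorem dim46 (N : Matrix (Fin 6 × Fin 6) (Fin 4 × Fin 6) (ZMod 2))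
    (G : (Fin 4 × Fin 6 → ZMod 2) →ₗ[ZMod 2] (Fin 4 → ZMod 2))
    (h : ∀ v, G v = 0 → N.transpose.mulVec (N.mulVec v) = 0) :
    4 ≤ Module.finrank (ZMod 2) (LinearMap.ker N.mulVecLin) := by
  have r1 := LinearMap.finrank_range_add_finrank_ker N.mulVecLin
  have r2 := LinearMap.finrank_range_add_finrank_ker N.transpose.mulVecLin
  have r3 := LinearMap.finrank_range_add_finrank_ker G
  have r4 := LinearMap.finrank_range_add_finrank_ker (N.mulVecLin.domRestrict (LinearMap.ker G))
  have rt : N.transpose.rank = N.rank := Matrix.rank_transpose N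
  unfold Matrix.rank at rt
  have g : Module.finrank (ZMod 2) (LinearMap.range G) ≤ 4 := by
    have := Submodule.finrank_le (LinearMap.range G)
    simpa using this
  have s1 : Module.finrank (ZMod 2) (LinearMap.range (N.mulVecLin.domRestrict (LinearMap.ker G))) ≤
      Module.finrank (ZMod 2) (LinearMap.ker N.transpose.mulVecLin) := by
    apply Submodule.finrank_mono
    rintro _ ⟨⟨v, hv⟩, rfl⟩
    exact h v hv
  have s2 : Module.finrank (ZMod 2) (LinearMap.ker (N.mulVecLin.domRestrict (LinearMap.ker G))) ≤
      Module.finrank (ZMod 2) (LinearMap.ker N.mulVecLin) := by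
    let φ : LinearMap.ker (N.mulVecLin.domRestrict (LinearMap.ker G)) →ₗ[ZMod 2]
        LinearMap.ker N.mulVecLin :=
      LinearMap.codRestrict _ ((LinearMap.ker G).subtype ∘ₗ
        (LinearMap.ker (N.mulVecLin.domRestrict (LinearMap.ker G))).subtype) (fun z => z.2)
    apply LinearMap.finrank_le_finrank_of_injective (f := φ)
    intro a b hab
    have := congrArg Subtype.val hab
    exact Subtype.ext (Subtype.ext this)
  simp only [Module.finrank_fintype_fun_eq_card, Fintype.card_prod, Fintype.card_fin] at r1 r2 r3
  omega

theorem noTD46 {B : (Fin 4 → Fin 6) → Prop} (hB : TD46 B) : False := by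
  choose blk k1 k2 k3 using hB.ex 0 1 (by decide)
  have cover : ∀ x, B x → x = blk (x 0) (x 1) := fun x hx =>
    hB.uniq 0 1 (by decide) _ _ hx (k1 _ _) (by rw [k2]) (by rw [k3])
  let N : Matrix (Fin 6 × Fin 6) (Fin 4 × Fin 6) (ZMod 2) :=
    fun s q => if blk s.1 s.2 q.1 = q.2 then 1 else 0
  let G : (Fin 4 × Fin 6 → ZMod 2) →ₗ[ZMod 2] (Fin 4 → ZMod 2) :=
    { toFun := fun v i => ∑ a, v (i, a)
      map_add' := by intro v w; funext i; simp [Finset.sum_add_distrib]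
      map_smul' := by intro c v; funext i; simp [Finset.mul_sum] }
  have Nmul : ∀ v s, N.mulVec v s = ∑ i, v (i, blk s.1 s.2 i) := by
    intro v s
    simp only [Matrix.mulVec, dotProduct, N, Fintype.sum_prod_type]
    simp
  have gram1 : ∀ i j, i ≠ j → ∀ a b, ∑ s, N s (i, a) * N s (j, b) = 1 := by
    intro i j hij a b
    obtain ⟨x, hx, hi, hj⟩ := hB.ex i j hij a b
    rw [Finset.sum_eq_single (x 0, x 1)]
    · simp only [N]
      rw [← cover x hx]
      simp [hi, hj]
    · rintro ⟨p, q⟩ _ hne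
      simp only [N]
      by_cases h1 : blk p q i = a
      · by_cases h2 : blk p q j = b
        · exfalso
          apply hne
          have := hB.uniq i j hij _ _ (k1 p q) hx (by rw [h1, hi]) (by rw [h2, hj])
          rw [← this, k2, k3]
        · simp [h2]
      · simp [h1]
    · intro h; exact absurd (Finset.mem_univ _) h
  have sumN : ∀ s j, ∑ b, N s (j, b) = 1 := by
    intro s j; simp [N]
  have gram0 : ∀ i a b, ∑ s, N s (i, a) * N s (i, b) = 0 := by
    intro i a b
    by_cases hab : a = b
    · subst hab
      obtain ⟨j, hij⟩ : ∃ j : Fin 4, i ≠ j := by revert i; decide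
      have sq : ∀ s, N s (i, a) * N s (i, a) = ∑ b, N s (i, a) * N s (j, b) := by
        intro s
        rw [← Finset.mul_sum, sumN]
        simp [N]
      simp only [sq]
      rw [Finset.sum_comm]
      simp only [gram1 i j hij]
      decide
    · apply Finset.sum_eq_zero
      intro s _
      simp only [N]
      by_cases h1 : blk s.1 s.2 i = a
      · simp [h1, hab]
      · simp [h1]
  have hdim := dim46 N G (by
    intro v hv
    have hv' : ∀ i, ∑ a, v (i, a) = 0 := fun i => congrFun hv i
    rw [Matrix.mulVec_mulVec]
    funext ⟨i, a⟩
    simp only [Matrix.mulVec, dotProduct, Matrix.mul_apply, Matrix.transpose_apply,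
      Fintype.sum_prod_type (f := fun q : Fin 4 × Fin 6 => _ * v q), Pi.zero_apply]
    apply Finset.sum_eq_zero
    intro j _
    by_cases hij : i = j
    · subst hij
      simp only [gram0, zero_mul, Finset.sum_const_zero]
    · simp only [gram1 i j hij, one_mul, hv' j])
  have kev : ∀ u ∈ LinearMap.ker N.mulVecLin, Ev46 B (fun i a => u (i, a)) := by
    intro u hu x hx
    have h : N.mulVec u = 0 := hu
    have := congrFun h (x 0, x 1)
    rw [Nmul] at this
    simp only [← cover x hx] at this
    exact this
  have con : ∀ u ∈ LinearMap.ker N.mulVecLin, ∀ i a, u (i, a) = u (i, 0) := by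
    intro u hu i a
    by_contra h
    exact noEv46 hB (kev u hu) ⟨i, a, h⟩
  let φ : LinearMap.ker N.mulVecLin →ₗ[ZMod 2] (Fin 3 → ZMod 2) :=
    { toFun := fun u i => u.1 (i.castSucc, 0)
      map_add' := by intro v w; funext i; simp
      map_smul' := by intro c v; funext i; simp }
  have hinj : Function.Injective φ := by
    rw [← LinearMap.ker_eq_bot, LinearMap.ker_eq_bot']
    rintro ⟨u, hu⟩ h
    have c := con u hu
    have e := kev u hu _ (k1 0 0)
    rw [Fin.sum_univ_four] at e
    have z0 : u (0, 0) = 0 := congrFun h 0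
    have z1 : u (1, 0) = 0 := congrFun h 1
    have z2 : u (2, 0) = 0 := congrFun h 2
    beta_reduce at e
    rw [c 0, c 1, c 2, c 3, z0, z1, z2] at e
    have z3 : u (3, 0) = 0 := by simpa using e
    apply Subtype.ext
    funext ⟨i, a⟩
    change u (i, a) = 0
    rw [c i a]
    fin_cases i
    · exact z0
    · exact z1
    · exact z2
    · exact z3
  have := LinearMap.finrank_le_finrank_of_injective hinj
  simp only [Module.finrank_fintype_fun_eq_card, Fintype.card_fin] at this
  omega

theorem netTD46 {A : Fin 4 → Finset (Submodule ℂ (Fin 3 → ℂ))}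
    {χ : Finset (Submodule ℂ (Fin 3 → ℂ))} (h : IsNet 4 6 A χ) :
    ∃ B, TD46 B := by
  let e : ∀ i, Fin 6 ≃ A i := fun i => (Finset.equivFinOfCardEq (h.card_eq i)).symm
  refine ⟨fun x => ∃ X ∈ χ, ∀ i, X ≤ (e i (x i)).1, ?_, ?_⟩
  · intro i j hij a b
    obtain ⟨-, hX⟩ := h.inter_mem i j hij _ (e i a).2 _ (e j b).2
    have H := fun t => h.unique_line _ hX t
    choose ℓ hℓ hu using H
    have hi : (e i a).1 = ℓ i := hu i _ ⟨(e i a).2, inf_le_left⟩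
    have hj : (e j b).1 = ℓ j := hu j _ ⟨(e j b).2, inf_le_right⟩
    refine ⟨fun t => (e t).symm ⟨ℓ t, (hℓ t).1⟩, ⟨_, hX, ?_⟩, ?_, ?_⟩
    · intro t
      simpa using (hℓ t).2
    · rw [Equiv.symm_apply_eq]; exact Subtype.ext hi.symm
    · rw [Equiv.symm_apply_eq]; exact Subtype.ext hj.symm
  · rintro i j hij x y ⟨X, hX, hx⟩ ⟨Y, hY, hy⟩ hi hj
    obtain ⟨-, hZ⟩ := h.inter_mem i j hij _ (e i (x i)).2 _ (e j (x j)).2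
    have dZ := h.point_dim _ hZ
    have hXZ : X = (e i (x i)).1 ⊓ (e j (x j)).1 :=
      Submodule.eq_of_le_of_finrank_eq (le_inf (hx i) (hx j)) (by rw [h.point_dim X hX, dZ])
    have hYZ : Y = (e i (x i)).1 ⊓ (e j (x j)).1 :=
      Submodule.eq_of_le_of_finrank_eq (le_inf (hi ▸ hy i) (hj ▸ hy j))
        (by rw [h.point_dim Y hY, dZ])
    have hXY : X = Y := hXZ.trans hYZ.symm
    funext t
    apply (e t).injective
    apply Subtype.ext
    exact (h.unique_line X hX t).unique ⟨(e t (x t)).2, hx t⟩ ⟨(e t (y t)).2, hXY ▸ hy t⟩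

/-- There does not exist a `(4,6)`-net in `ℂℙ²`. -/
theorem no_net_4_6 :
    ¬ ∃ (A : Fin 4 → Finset (Submodule ℂ (Fin 3 → ℂ)))
        (χ : Finset (Submodule ℂ (Fin 3 → ℂ))), IsNet 4 6 A χ := by
  rintro ⟨A, χ, h⟩
  obtain ⟨B, hB⟩ := netTD46 h
  exact noTD46 hB
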